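/- Let A ∈ ℂ^{N_r×L}, let H_1,…,H_N ∈ ℂ^{N_r×N_t}, let σ² ≥ 0, and suppose that for every n the matrix A^H H_n H_n^H A is invertible. Define the zero-forcing precoders B_n* = (A^H H_n)^H (A^H H_n H_n^H A)^{-1}. Then for every choice of precoders B_1,…,B_N ∈ ℂ^{N_t×L}, the transmission MSE satisfies MSE(A,{B_n}) ≥ MSE(A,{B_n*}); that is, the zero-forcing precoders minimize the transmission MSE for the given aggregation beamformer A. -/

import Mathlib

open Matrix
open scoped ComplexOrder

/-- Transmission MSE: MSE(A,{Bₙ}) = Σₙ tr((AᴴHₙBₙ − I)(AᴴHₙBₙ − I)ᴴ) + σ² tr(AᴴA). -/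
noncomputable def MSE {Nr Nt L N : ℕ} (A : Matrix (Fin Nr) (Fin L) ℂ)
    (H : Fin N → Matrix (Fin Nr) (Fin Nt) ℂ)
    (B : Fin N → Matrix (Fin Nt) (Fin L) ℂ) (σ2 : ℝ) : ℂ :=
  (∑ n, ((Aᴴ * H n * B n - 1) * (Aᴴ * H n * B n - 1)ᴴ).trace) + (σ2 : ℂ) * (Aᴴ * A).trace

/-- Zero-forcing precoder B* = (Aᴴ H)ᴴ (Aᴴ H Hᴴ A)⁻¹. -/
noncomputable def zfPrecoder {Nr Nt L : ℕ} (A : Matrix (Fin Nr) (Fin L) ℂ)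
    (H : Matrix (Fin Nr) (Fin Nt) ℂ) : Matrix (Fin Nt) (Fin L) ℂ :=
  (Aᴴ * H)ᴴ * (Aᴴ * H * Hᴴ * A)⁻¹

theorem mul_zfPrecoder {Nr Nt L : ℕ} (A : Matrix (Fin Nr) (Fin L) ℂ)
    (H : Matrix (Fin Nr) (Fin Nt) ℂ) (hinv : IsUnit (Aᴴ * H * Hᴴ * A)) :
    Aᴴ * H * zfPrecoder A H = 1 := by
  have hdet := (Matrix.isUnit_iff_isUnit_det _).mp hinv
  rw [zfPrecoder, ← Matrix.mul_assoc, conjTranspose_mul, conjTranspose_conjTranspose,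
    ← Matrix.mul_assoc, Matrix.mul_nonsing_inv _ hdet]

/-- the zero-forcing precoders minimize the transmission MSE for the
given aggregation beamformer A. -/
theorem zero_forcing_minimizes_MSE {Nr Nt L N : ℕ}
    (A : Matrix (Fin Nr) (Fin L) ℂ)
    (H : Fin N → Matrix (Fin Nr) (Fin Nt) ℂ)
    (σ2 : ℝ) (hσ : 0 ≤ σ2)
    (hinv : ∀ n, IsUnit (Aᴴ * H n * (H n)ᴴ * A))
    (B : Fin N → Matrix (Fin Nt) (Fin L) ℂ) :
    MSE A H (fun n => zfPrecoder A (H n)) σ2 ≤ MSE A H B σ2 := by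
  unfold MSE
  gcongr with n
  rw [mul_zfPrecoder A (H n) (hinv n), sub_self, Matrix.zero_mul, trace_zero]
  exact (posSemidef_self_mul_conjTranspose _).trace_nonneg
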